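/- arXiv:2306.02060 — 5 statements merged into one kernel-verified Lean document; each statement's English description precedes it below -/
import Mathlib

section
/- Let μ₀ be a probability measure on X, let G_m : X → ℝ^d (m ∈ ℕ) and G_∞ : X → ℝ^d be measurable, and suppose G_m(u) → G_∞(u) as m → ∞ for μ₀-almost every u ∈ X. Then for every y ∈ ℝ^d the normalization constants converge: Z_{G_m}(y) → Z_{G_∞}(y) as m → ∞. -/
open MeasureTheory Real Filter

/-- The squared norm induced by the inverse of the diagonal covariance matrix
`Γ = diag(σ₁², …, σ_d²)`: `|v|_Γ² = ∑ i, σ i ⁻² * (v i)²`. -/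
noncomputable def gammaNormSq {d : ℕ} (σ : Fin d → ℝ) (v : EuclideanSpace ℝ (Fin d)) : ℝ :=
  ∑ i, (v i) ^ 2 / (σ i) ^ 2

/-- The Bayesian potential `Φ_G(u, y) = ½|G(u) − y|_Γ² − ½|y|_Γ²`. -/
noncomputable def potential {X : Type*} {d : ℕ} (σ : Fin d → ℝ)
    (G : X → EuclideanSpace ℝ (Fin d)) (u : X) (y : EuclideanSpace ℝ (Fin d)) : ℝ :=
  (1 / 2) * gammaNormSq σ (G u - y) - (1 / 2) * gammaNormSq σ y

/-- The normalization constant `Z_G(y) = ∫_X exp(−Φ_G(u, y)) dμ₀(u)`. -/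
noncomputable def Zconst {X : Type*} [MeasurableSpace X] {d : ℕ} (σ : Fin d → ℝ)
    (G : X → EuclideanSpace ℝ (Fin d)) (μ₀ : Measure X)
    (y : EuclideanSpace ℝ (Fin d)) : ℝ :=
  ∫ u, Real.exp (-(potential σ G u y)) ∂μ₀

theorem stmt_9 {X : Type*} [MeasurableSpace X] {d : ℕ} (hd : 1 ≤ d)
    (σ : Fin d → ℝ) (hσ : ∀ i, 0 < σ i)
    (μ₀ : Measure X) [IsProbabilityMeasure μ₀]
    (G : ℕ → X → EuclideanSpace ℝ (Fin d)) (Ginf : X → EuclideanSpace ℝ (Fin d))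
    (hGm : ∀ m, Measurable (G m)) (hGinf : Measurable Ginf)
    (hconv : ∀ᵐ u ∂μ₀, Tendsto (fun m => G m u) atTop (nhds (Ginf u)))
    (y : EuclideanSpace ℝ (Fin d)) :
    Tendsto (fun m => Zconst σ (G m) μ₀ y) atTop (nhds (Zconst σ Ginf μ₀ y)) := by
  have hc : Continuous (fun v : EuclideanSpace ℝ (Fin d) =>
      Real.exp (-((1 / 2) * gammaNormSq σ (v - y) - (1 / 2) * gammaNormSq σ y))) := by
    have h : Continuous (gammaNormSq σ) := by
      unfold gammaNormSq
      refine continuous_finsetSum _ fun i _ => Continuous.div_const ?_ _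
      fun_prop
    fun_prop
  have hnn : ∀ v : EuclideanSpace ℝ (Fin d), 0 ≤ gammaNormSq σ v := fun v =>
    Finset.sum_nonneg fun i _ => by positivity
  unfold Zconst potential
  refine tendsto_integral_of_dominated_convergence
    (fun _ => Real.exp ((1 / 2) * gammaNormSq σ y)) ?_ (integrable_const _) ?_ ?_
  · intro m
    exact (hc.measurable.comp (hGm m)).aestronglyMeasurable
  · intro m
    refine Eventually.of_forall fun u => ?_
    rw [Real.norm_eq_abs, abs_of_pos (Real.exp_pos _)]
    apply Real.exp_le_exp.mpr
    have := hnn (G m u - y)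
    linarith
  · filter_upwards [hconv] with u hu
    exact (hc.tendsto (Ginf u)).comp hu
end

section
/- Let μ₀ be a probability measure on a measurable space X, and let f₁, f₂ : X → [0, ∞) be measurable and μ₀-integrable with Z₁ := ∫_X f₁ dμ₀ > 0 and Z₂ := ∫_X f₂ dμ₀ > 0. Then the squared Hellinger distance between the normalized densities satisfies the decomposition bound ½ ∫_X (√(f₁/Z₁) − √(f₂/Z₂))² dμ₀ ≤ (1/Z₁) ∫_X (√f₁ − √f₂)² dμ₀ + |Z₁^{-1/2} − Z₂^{-1/2}|² · Z₂. -/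
open MeasureTheory Real

theorem stmt_10 {X : Type*} [MeasurableSpace X]
    (μ₀ : Measure X) [IsProbabilityMeasure μ₀]
    (f₁ f₂ : X → ℝ) (hf₁m : Measurable f₁) (hf₂m : Measurable f₂)
    (hf₁0 : ∀ u, 0 ≤ f₁ u) (hf₂0 : ∀ u, 0 ≤ f₂ u)
    (hf₁i : Integrable f₁ μ₀) (hf₂i : Integrable f₂ μ₀)
    (Z₁ Z₂ : ℝ) (hZ₁ : Z₁ = ∫ u, f₁ u ∂μ₀) (hZ₂ : Z₂ = ∫ u, f₂ u ∂μ₀)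
    (hZ₁pos : 0 < Z₁) (hZ₂pos : 0 < Z₂) :
    1 / 2 * ∫ u, (Real.sqrt (f₁ u / Z₁) - Real.sqrt (f₂ u / Z₂)) ^ 2 ∂μ₀ ≤
      (1 / Z₁) * (∫ u, (Real.sqrt (f₁ u) - Real.sqrt (f₂ u)) ^ 2 ∂μ₀) +
      |(Real.sqrt Z₁)⁻¹ - (Real.sqrt Z₂)⁻¹| ^ 2 * Z₂ := by
  have hD : Integrable (fun u => (Real.sqrt (f₁ u) - Real.sqrt (f₂ u)) ^ 2) μ₀ := by
    refine (hf₁i.add hf₂i).mono'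
      ((hf₁m.sqrt.sub hf₂m.sqrt).pow_const 2).aestronglyMeasurable
      (Filter.Eventually.of_forall fun u => ?_)
    rw [Real.norm_of_nonneg (sq_nonneg _)]
    have h1 := Real.sq_sqrt (hf₁0 u)
    have h2 := Real.sq_sqrt (hf₂0 u)
    have h3 := mul_nonneg (Real.sqrt_nonneg (f₁ u)) (Real.sqrt_nonneg (f₂ u))
    simp only [Pi.add_apply]
    nlinarith
  have key : ∫ u, (Real.sqrt (f₁ u / Z₁) - Real.sqrt (f₂ u / Z₂)) ^ 2 ∂μ₀ ≤
      ∫ u, (2 * (1 / Z₁) * (Real.sqrt (f₁ u) - Real.sqrt (f₂ u)) ^ 2 +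
        2 * ((Real.sqrt Z₁)⁻¹ - (Real.sqrt Z₂)⁻¹) ^ 2 * f₂ u) ∂μ₀ := by
    refine integral_mono_of_nonneg (Filter.Eventually.of_forall fun u => sq_nonneg _)
      ((hD.const_mul _).add (hf₂i.const_mul _)) (Filter.Eventually.of_forall fun u => ?_)
    have h2 := Real.sq_sqrt (hf₂0 u)
    have hz : (1 / Z₁) = ((Real.sqrt Z₁)⁻¹) ^ 2 := by
      rw [inv_pow, Real.sq_sqrt hZ₁pos.le, one_div]
    simp only []
    rw [Real.sqrt_div (hf₁0 u), Real.sqrt_div (hf₂0 u), hz, div_eq_mul_inv, div_eq_mul_inv]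
    nth_rewrite 3 [← h2]
    generalize (Real.sqrt Z₁)⁻¹ = a
    generalize (Real.sqrt Z₂)⁻¹ = b
    generalize Real.sqrt (f₁ u) = s
    generalize Real.sqrt (f₂ u) = t
    nlinarith [sq_nonneg (a * (s - t) - (a - b) * t)]
  rw [integral_add (hD.const_mul _) (hf₂i.const_mul _), integral_const_mul,
    integral_const_mul, ← hZ₂] at key
  rw [sq_abs]
  linarith
end

section
/- Let μ₀ be a probability measure on X, let G_m : X → ℝ^d (m ∈ ℕ) and G_∞ : X → ℝ^d be measurable with G_m(u) → G_∞(u) as m → ∞ for μ₀-almost every u ∈ X. Fix y ∈ ℝ^d and suppose Z_{G_∞}(y) > 0 and Z_{G_m}(y) > 0 for every m. Then the posterior measures converge in Hellinger distance: d_H(μ_{G_m}^y, μ_{G_∞}^y) = (½ ∫_X (√(exp(−Φ_{G_m}(u,y))/Z_{G_m}(y)) − √(exp(−Φ_{G_∞}(u,y))/Z_{G_∞}(y)))² dμ₀(u))^{1/2} → 0 as m → ∞. -/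
open MeasureTheory Real Filter

lemma gammaNormSq_nonneg' {d : ℕ} (σ : Fin d → ℝ) (v : EuclideanSpace ℝ (Fin d)) :
    0 ≤ gammaNormSq σ v := by
  unfold gammaNormSq
  positivity

lemma gammaNormSq_cont {d : ℕ} (σ : Fin d → ℝ) : Continuous (gammaNormSq σ) := by
  unfold gammaNormSq
  simp only [div_eq_mul_inv]
  fun_prop

theorem stmt_12 {X : Type*} [MeasurableSpace X] {d : ℕ} (hd : 1 ≤ d)
    (σ : Fin d → ℝ) (hσ : ∀ i, 0 < σ i)
    (μ₀ : Measure X) [IsProbabilityMeasure μ₀]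
    (G : ℕ → X → EuclideanSpace ℝ (Fin d)) (Ginf : X → EuclideanSpace ℝ (Fin d))
    (hGm : ∀ m, Measurable (G m)) (hGinf : Measurable Ginf)
    (hconv : ∀ᵐ u ∂μ₀, Tendsto (fun m => G m u) atTop (nhds (Ginf u)))
    (y : EuclideanSpace ℝ (Fin d))
    (hZinf : 0 < Zconst σ Ginf μ₀ y) (hZm : ∀ m, 0 < Zconst σ (G m) μ₀ y) :
    Tendsto (fun m => Real.sqrt (1 / 2 * ∫ u,
        (Real.sqrt (Real.exp (-(potential σ (G m) u y)) / Zconst σ (G m) μ₀ y) -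
         Real.sqrt (Real.exp (-(potential σ Ginf u y)) / Zconst σ Ginf μ₀ y)) ^ 2 ∂μ₀))
      atTop (nhds 0) := by
  have hcΦ : Continuous (fun v : EuclideanSpace ℝ (Fin d) =>
      Real.exp (-((1 / 2) * gammaNormSq σ (v - y) - (1 / 2) * gammaNormSq σ y))) := by
    have h := (gammaNormSq_cont σ).comp (continuous_id.sub (continuous_const (y := y)))
    exact Real.continuous_exp.comp ((continuous_const.mul h).sub continuous_const).neg
  have hmeas : ∀ F : X → EuclideanSpace ℝ (Fin d), Measurable F →
      Measurable (fun u => Real.exp (-(potential σ F u y))) := fun F hF =>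
    hcΦ.measurable.comp hF
  have hlim : ∀ᵐ u ∂μ₀, Tendsto (fun m => Real.exp (-(potential σ (G m) u y))) atTop
      (nhds (Real.exp (-(potential σ Ginf u y)))) := by
    filter_upwards [hconv] with u hu
    exact (hcΦ.tendsto (Ginf u)).comp hu
  set K := Real.exp ((1 / 2) * gammaNormSq σ y) with hK
  have hK0 : 0 < K := Real.exp_pos _
  have hbd : ∀ (F : X → EuclideanSpace ℝ (Fin d)) u, Real.exp (-(potential σ F u y)) ≤ K := by
    intro F u
    apply Real.exp_le_exp.2
    have := gammaNormSq_nonneg' σ (F u - y)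
    unfold potential
    linarith
  have hZ : Tendsto (fun m => Zconst σ (G m) μ₀ y) atTop (nhds (Zconst σ Ginf μ₀ y)) := by
    refine tendsto_integral_of_dominated_convergence (fun _ => K)
      (fun m => (hmeas _ (hGm m)).aestronglyMeasurable) (integrable_const _) ?_ hlim
    intro m
    refine Eventually.of_forall fun u => ?_
    rw [Real.norm_of_nonneg (Real.exp_pos _).le]
    exact hbd _ _
  set Z := Zconst σ Ginf μ₀ y with hZdef
  have hev : ∀ᶠ m in atTop, Z / 2 < Zconst σ (G m) μ₀ y :=
    hZ.eventually (lt_mem_nhds (by linarith))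
  have hint : Tendsto (fun m => ∫ u,
        (Real.sqrt (Real.exp (-(potential σ (G m) u y)) / Zconst σ (G m) μ₀ y) -
         Real.sqrt (Real.exp (-(potential σ Ginf u y)) / Z)) ^ 2 ∂μ₀) atTop
         (nhds (∫ _u, (0 : ℝ) ∂μ₀)) := by
    refine tendsto_integral_filter_of_dominated_convergence (fun _ => K / (Z / 2) + K / Z)
      ?_ ?_ (integrable_const _) ?_
    · refine Eventually.of_forall fun m => Measurable.aestronglyMeasurable ?_
      exact (((hmeas _ (hGm m)).div_const _).sqrt.sub
        ((hmeas _ hGinf).div_const _).sqrt).pow_const 2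
    · filter_upwards [hev] with m hm
      refine Eventually.of_forall fun u => ?_
      rw [Real.norm_of_nonneg (sq_nonneg _)]
      have e1 : Real.exp (-(potential σ (G m) u y)) / Zconst σ (G m) μ₀ y ≤ K / (Z / 2) :=
        div_le_div₀ hK0.le (hbd _ _) (by linarith) hm.le
      have e2 : Real.exp (-(potential σ Ginf u y)) / Z ≤ K / Z :=
        div_le_div_of_nonneg_right (hbd _ _) hZinf.le
      have p1 := Real.sq_sqrt (div_nonneg (Real.exp_pos (-(potential σ (G m) u y))).le (hZm m).le)
      have p2 := Real.sq_sqrt (div_nonneg (Real.exp_pos (-(potential σ Ginf u y))).le hZinf.le)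
      have q := mul_nonneg
        (Real.sqrt_nonneg (Real.exp (-(potential σ (G m) u y)) / Zconst σ (G m) μ₀ y))
        (Real.sqrt_nonneg (Real.exp (-(potential σ Ginf u y)) / Z))
      rw [sub_sq, p1, p2]
      linarith
    · filter_upwards [hlim] with u hu
      have h := (((hu.div hZ hZinf.ne').sqrt).sub_const
        (Real.sqrt (Real.exp (-(potential σ Ginf u y)) / Z))).pow 2
      simpa using h
  have h := (hint.const_mul (1 / 2)).sqrt
  simpa using h
end

section
/- Let μ₀ be a probability measure on X, let G_m : X → ℝ^d (m ∈ ℕ) and G_∞ : X → ℝ^d be measurable with G_m(u) → G_∞(u) as m → ∞ for μ₀-almost every u ∈ X. Fix y ∈ ℝ^d and suppose Z_{G_∞}(y) > 0 and Z_{G_m}(y) > 0 for every m. Then the family of posterior measures is Cauchy in Hellinger distance: for every ε > 0 there exists M ∈ ℕ such that for all m₁, m₂ ≥ M one has d_H(μ_{G_{m₁}}^y, μ_{G_{m₂}}^y) < ε. -/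
open MeasureTheory Real Filter

theorem potential_tendsto {X : Type*} {d : ℕ} (σ : Fin d → ℝ)
    (G : ℕ → X → EuclideanSpace ℝ (Fin d)) (Ginf : X → EuclideanSpace ℝ (Fin d))
    (y : EuclideanSpace ℝ (Fin d)) (u : X)
    (h : Tendsto (fun m => G m u) atTop (nhds (Ginf u))) :
    Tendsto (fun m => Real.exp (-(potential σ (G m) u y))) atTop
      (nhds (Real.exp (-(potential σ Ginf u y)))) := by
  have hc : Continuous (fun v : EuclideanSpace ℝ (Fin d) =>
      Real.exp (-((1 / 2) * gammaNormSq σ (v - y) - (1 / 2) * gammaNormSq σ y))) := by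
    unfold gammaNormSq
    fun_prop
  exact (hc.tendsto (Ginf u)).comp h

theorem exp_potential_measurable {X : Type*} [MeasurableSpace X] {d : ℕ} (σ : Fin d → ℝ)
    (G : X → EuclideanSpace ℝ (Fin d)) (hG : Measurable G)
    (y : EuclideanSpace ℝ (Fin d)) :
    Measurable (fun u => Real.exp (-(potential σ G u y))) := by
  have hc : Continuous (fun v : EuclideanSpace ℝ (Fin d) =>
      Real.exp (-((1 / 2) * gammaNormSq σ (v - y) - (1 / 2) * gammaNormSq σ y))) := by
    unfold gammaNormSq
    fun_prop
  exact hc.measurable.comp hG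

theorem exp_potential_le {X : Type*} {d : ℕ} (σ : Fin d → ℝ)
    (G : X → EuclideanSpace ℝ (Fin d)) (y : EuclideanSpace ℝ (Fin d)) (u : X) :
    Real.exp (-(potential σ G u y)) ≤ Real.exp ((1 / 2) * gammaNormSq σ y) := by
  apply Real.exp_le_exp.mpr
  have : 0 ≤ gammaNormSq σ (G u - y) := Finset.sum_nonneg fun i _ => by positivity
  unfold potential
  linarith

theorem stmt_13 {X : Type*} [MeasurableSpace X] {d : ℕ} (hd : 1 ≤ d)
    (σ : Fin d → ℝ) (hσ : ∀ i, 0 < σ i)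
    (μ₀ : Measure X) [IsProbabilityMeasure μ₀]
    (G : ℕ → X → EuclideanSpace ℝ (Fin d)) (Ginf : X → EuclideanSpace ℝ (Fin d))
    (hGm : ∀ m, Measurable (G m)) (hGinf : Measurable Ginf)
    (hconv : ∀ᵐ u ∂μ₀, Tendsto (fun m => G m u) atTop (nhds (Ginf u)))
    (y : EuclideanSpace ℝ (Fin d))
    (hZinf : 0 < Zconst σ Ginf μ₀ y) (hZm : ∀ m, 0 < Zconst σ (G m) μ₀ y) :
    ∀ ε > (0 : ℝ), ∃ M : ℕ, ∀ m₁ ≥ M, ∀ m₂ ≥ M,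
      Real.sqrt (1 / 2 * ∫ u,
        (Real.sqrt (Real.exp (-(potential σ (G m₁) u y)) / Zconst σ (G m₁) μ₀ y) -
         Real.sqrt (Real.exp (-(potential σ (G m₂) u y)) / Zconst σ (G m₂) μ₀ y)) ^ 2 ∂μ₀)
        < ε := by
  intro ε hε
  set C := Real.exp ((1 / 2) * gammaNormSq σ y) with hC
  have hCpos : 0 < C := Real.exp_pos _
  have hZ : Tendsto (fun m => Zconst σ (G m) μ₀ y) atTop (nhds (Zconst σ Ginf μ₀ y)) := by
    unfold Zconst
    refine tendsto_integral_of_dominated_convergence (fun _ => C)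
      (fun m => (exp_potential_measurable σ (G m) (hGm m) y).aestronglyMeasurable)
      (integrable_const _) (fun m => ?_) ?_
    · refine Eventually.of_forall fun u => ?_
      rw [Real.norm_of_nonneg (Real.exp_pos _).le]
      exact exp_potential_le σ (G m) y u
    · filter_upwards [hconv] with u hu
      exact potential_tendsto σ G Ginf y u hu
  set K := C / (Zconst σ Ginf μ₀ y / 2) with hK
  have hZev : ∀ᶠ m in atTop, Zconst σ Ginf μ₀ y / 2 < Zconst σ (G m) μ₀ y :=
    hZ.eventually (lt_mem_nhds (by linarith))
  have key : Tendsto (fun p : ℕ × ℕ => ∫ u,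
        (Real.sqrt (Real.exp (-(potential σ (G p.1) u y)) / Zconst σ (G p.1) μ₀ y) -
         Real.sqrt (Real.exp (-(potential σ (G p.2) u y)) / Zconst σ (G p.2) μ₀ y)) ^ 2 ∂μ₀)
      (atTop ×ˢ atTop) (nhds (∫ _, (0 : ℝ) ∂μ₀)) := by
    refine tendsto_integral_filter_of_dominated_convergence (fun _ => K + K) ?_ ?_
      (integrable_const _) ?_
    · refine Eventually.of_forall fun p => Measurable.aestronglyMeasurable ?_
      have h1 := exp_potential_measurable σ (G p.1) (hGm p.1) y
      have h2 := exp_potential_measurable σ (G p.2) (hGm p.2) y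
      exact (((h1.div_const _).sqrt).sub ((h2.div_const _).sqrt)).pow_const 2
    · filter_upwards [hZev.prod_mk hZev] with p hp
      refine Eventually.of_forall fun u => ?_
      rw [Real.norm_of_nonneg (sq_nonneg _)]
      have bd : ∀ m, Zconst σ Ginf μ₀ y / 2 < Zconst σ (G m) μ₀ y →
          Real.exp (-(potential σ (G m) u y)) / Zconst σ (G m) μ₀ y ≤ K := fun m hm =>
        div_le_div₀ hCpos.le (exp_potential_le σ (G m) y u) (by linarith) hm.le
      have b1 := bd p.1 hp.1
      have b2 := bd p.2 hp.2
      have e1 := Real.sq_sqrt (div_nonneg (Real.exp_pos (-(potential σ (G p.1) u y))).le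
        (hZm p.1).le)
      have e2 := Real.sq_sqrt (div_nonneg (Real.exp_pos (-(potential σ (G p.2) u y))).le
        (hZm p.2).le)
      have n1 := Real.sqrt_nonneg (Real.exp (-(potential σ (G p.1) u y)) / Zconst σ (G p.1) μ₀ y)
      have n2 := Real.sqrt_nonneg (Real.exp (-(potential σ (G p.2) u y)) / Zconst σ (G p.2) μ₀ y)
      have n3 := mul_nonneg n1 n2
      rw [sub_sq]
      linarith
    · filter_upwards [hconv] with u hu
      have h := ((potential_tendsto σ G Ginf y u hu).div hZ hZinf.ne').sqrt
      have h3 := ((h.comp tendsto_fst).sub (h.comp tendsto_snd) :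
        Tendsto _ ((atTop : Filter ℕ) ×ˢ (atTop : Filter ℕ)) _).pow 2
      simpa using h3
  have key2 := (key.const_mul (1 / 2)).sqrt
  simp only [integral_zero, mul_zero, Real.sqrt_zero] at key2
  have hev := key2.eventually (gt_mem_nhds hε)
  rw [prod_atTop_atTop_eq, eventually_atTop] at hev
  obtain ⟨⟨a, b⟩, hab⟩ := hev
  exact ⟨max a b, fun m₁ h₁ m₂ h₂ => hab (m₁, m₂)
    ⟨(le_max_left a b).trans h₁, (le_max_right a b).trans h₂⟩⟩
end

section
/- Let μ₀ be a probability measure on X, let G_m : X → ℝ^d (m ∈ ℕ) and G_∞ : X → ℝ^d be measurable with G_m(u) → G_∞(u) as m → ∞ for μ₀-almost every u ∈ X. Suppose in addition that sup_m ∫_X |G_m(u)|² dμ₀(u) < ∞, that Z_{G_∞}(y) > 0 for every y, and that there exist a measurable set X₀ ⊆ X with μ₀(X₀) > 0 and B ≥ 0 such that |G_m(u)| ≤ B for all m ∈ ℕ and all u ∈ X₀. Then for every r > 0 and every ε > 0 there exist a constant C > 0 and M ∈ ℕ such that for all m₁, m₂ ≥ M and all y₁, y₂ ∈ ℝ^d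 with |y₁| ≤ r and |y₂| ≤ r, the posterior measures satisfy d_H(μ_{G_{m₁}}^{y₁}, μ_{G_{m₂}}^{y₂}) ≤ C|y₁ − y₂| + ε. -/
open MeasureTheory Real Filter

noncomputable def scaleT {d : ℕ} (σ : Fin d → ℝ) :
    EuclideanSpace ℝ (Fin d) →ₗ[ℝ] EuclideanSpace ℝ (Fin d) where
  toFun v := WithLp.toLp 2 (fun i => v i / σ i)
  map_add' v w := by ext i; simp [add_div]
  map_smul' a v := by ext i; simp [mul_div_assoc]

lemma gammaNormSq_eq {d : ℕ} (σ : Fin d → ℝ) (v : EuclideanSpace ℝ (Fin d)) :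
    gammaNormSq σ v = ‖scaleT σ v‖ ^ 2 := by
  rw [EuclideanSpace.norm_sq_eq]
  simp [gammaNormSq, scaleT, div_pow]

lemma exists_scale_bound {d : ℕ} (σ : Fin d → ℝ) :
    ∃ c : ℝ, 0 ≤ c ∧ ∀ v, ‖scaleT σ v‖ ≤ c * ‖v‖ :=
  ⟨‖LinearMap.toContinuousLinearMap (scaleT σ)‖, norm_nonneg _,
    fun v => (LinearMap.toContinuousLinearMap (scaleT σ)).le_opNorm v⟩

lemma exp_lip {R x y : ℝ} (hx : x ≤ R) (hy : y ≤ R) :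
    |Real.exp x - Real.exp y| ≤ Real.exp R * |x - y| := by
  wlog h : y ≤ x generalizing x y
  · rw [abs_sub_comm, abs_sub_comm x]
    exact this hy hx (le_of_not_ge h)
  have h1 : Real.exp y ≤ Real.exp x := Real.exp_le_exp.2 h
  rw [abs_of_nonneg (by linarith), abs_of_nonneg (by linarith)]
  have h2 : Real.exp x ≤ Real.exp R := Real.exp_le_exp.2 hx
  have h3 := Real.add_one_le_exp (y - x)
  have h4 : Real.exp y = Real.exp x * Real.exp (y - x) := by
    rw [← Real.exp_add]; congr 1; ring
  have h5 := Real.exp_pos x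
  nlinarith [mul_le_mul_of_nonneg_right h2 (sub_nonneg.2 h),
    mul_le_mul_of_nonneg_left h3 h5.le]

lemma gauss_lip (a b : ℝ) :
    |Real.exp (-(a ^ 2 / 4)) - Real.exp (-(b ^ 2 / 4))| ≤ |a - b| := by
  have hd : ∀ x ∈ (Set.univ : Set ℝ), HasDerivWithinAt (fun x : ℝ => Real.exp (-(x ^ 2 / 4)))
      (Real.exp (-(x ^ 2 / 4)) * (-(2 * x / 4))) Set.univ x := by
    intro x _
    have : HasDerivAt (fun x : ℝ => -(x ^ 2 / 4)) (-(2 * x / 4)) x := by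
      have h := ((hasDerivAt_pow 2 x).div_const 4).fun_neg
      norm_num at h
      exact h
    exact this.exp.hasDerivWithinAt
  have hb : ∀ x ∈ (Set.univ : Set ℝ), ‖Real.exp (-(x ^ 2 / 4)) * (-(2 * x / 4))‖ ≤ 1 := by
    intro x _
    rw [norm_mul, Real.norm_eq_abs, Real.norm_eq_abs, abs_of_pos (Real.exp_pos _), Real.exp_neg,
      inv_mul_le_iff₀ (Real.exp_pos _), mul_one, abs_neg]
    refine le_trans ?_ (Real.add_one_le_exp _)
    rw [abs_le]
    constructor <;> nlinarith [sq_nonneg (x - 1), sq_nonneg (x + 1)]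
  have := convex_univ.norm_image_sub_le_of_norm_hasDerivWithin_le hd hb
    (Set.mem_univ b) (Set.mem_univ a)
  simpa using this

/-- The square root of the unnormalised density. -/
noncomputable def rootD {d : ℕ} (σ : Fin d → ℝ) (g y : EuclideanSpace ℝ (Fin d)) : ℝ :=
  Real.exp (-(‖scaleT σ (g - y)‖ ^ 2 / 4)) * Real.exp (‖scaleT σ y‖ ^ 2 / 4)

lemma rootD_pos {d : ℕ} (σ : Fin d → ℝ) (g y : EuclideanSpace ℝ (Fin d)) : 0 < rootD σ g y := by
  unfold rootD; positivity

lemma rootD_sq {X : Type*} {d : ℕ} (σ : Fin d → ℝ) (G : X → EuclideanSpace ℝ (Fin d)) (u : X)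
    (y : EuclideanSpace ℝ (Fin d)) :
    Real.exp (-(potential σ G u y)) = rootD σ (G u) y ^ 2 := by
  unfold rootD potential
  rw [← Real.exp_add, ← Real.exp_nat_mul, gammaNormSq_eq, gammaNormSq_eq]
  congr 1; push_cast; ring

lemma rootD_le {d : ℕ} (σ : Fin d → ℝ) (g y : EuclideanSpace ℝ (Fin d)) :
    rootD σ g y ≤ Real.exp (‖scaleT σ y‖ ^ 2 / 4) := by
  unfold rootD
  have : Real.exp (-(‖scaleT σ (g - y)‖ ^ 2 / 4)) ≤ 1 := Real.exp_le_one_iff.2 (by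
    have := sq_nonneg ‖scaleT σ (g - y)‖; linarith)
  exact mul_le_of_le_one_left (Real.exp_pos _).le this

lemma rootD_lip {d : ℕ} (σ : Fin d → ℝ) (r : ℝ) (hr : 0 < r) :
    ∃ L : ℝ, 0 ≤ L ∧ ∀ g₁ g₂ y₁ y₂ : EuclideanSpace ℝ (Fin d), ‖y₁‖ ≤ r → ‖y₂‖ ≤ r →
      |rootD σ g₁ y₁ - rootD σ g₂ y₂| ≤ L * (min 1 ‖g₁ - g₂‖ + ‖y₁ - y₂‖) := by
  obtain ⟨c, hc, hT⟩ := exists_scale_bound σ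
  set K := Real.exp ((c * r) ^ 2 / 4) with hK
  have hKpos : 0 < K := Real.exp_pos _
  refine ⟨K * (1 + c) + K * (c * r) * c, by positivity, ?_⟩
  intro g₁ g₂ y₁ y₂ h1 h2
  have n1 : ‖scaleT σ y₁‖ ≤ c * r := (hT y₁).trans (by gcongr)
  have n2 : ‖scaleT σ y₂‖ ≤ c * r := (hT y₂).trans (by gcongr)
  have q1 : ‖scaleT σ y₁‖ ^ 2 / 4 ≤ (c * r) ^ 2 / 4 := by gcongr
  have q2 : ‖scaleT σ y₂‖ ^ 2 / 4 ≤ (c * r) ^ 2 / 4 := by gcongr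
  have hE := exp_lip q1 q2
  rw [← hK] at hE
  have e1 : Real.exp (‖scaleT σ y₁‖ ^ 2 / 4) ≤ K := Real.exp_le_exp.2 q1
  have hn : |‖scaleT σ y₁‖ - ‖scaleT σ y₂‖| ≤ c * ‖y₁ - y₂‖ := by
    refine (abs_norm_sub_norm_le _ _).trans ?_
    rw [← map_sub]; exact hT _
  have hEE : |Real.exp (‖scaleT σ y₁‖ ^ 2 / 4) - Real.exp (‖scaleT σ y₂‖ ^ 2 / 4)|
      ≤ K * (c * r) * c * ‖y₁ - y₂‖ := by
    have : |‖scaleT σ y₁‖ ^ 2 / 4 - ‖scaleT σ y₂‖ ^ 2 / 4| ≤ (c * r) * (c * ‖y₁ - y₂‖) := by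
      have : ‖scaleT σ y₁‖ ^ 2 / 4 - ‖scaleT σ y₂‖ ^ 2 / 4 =
        ((‖scaleT σ y₁‖ + ‖scaleT σ y₂‖) / 4) * (‖scaleT σ y₁‖ - ‖scaleT σ y₂‖) := by ring
      rw [this, abs_mul]
      have p1 := norm_nonneg (scaleT σ y₁)
      have p2 := norm_nonneg (scaleT σ y₂)
      rw [abs_of_nonneg (by positivity : 0 ≤ (‖scaleT σ y₁‖ + ‖scaleT σ y₂‖) / 4)]
      gcongr
      linarith
    calc _ ≤ _ := hE
      _ ≤ K * ((c * r) * (c * ‖y₁ - y₂‖)) := by gcongr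
      _ = _ := by ring
  set a := ‖scaleT σ (g₁ - y₁)‖
  set b := ‖scaleT σ (g₂ - y₂)‖
  have hab : |a - b| ≤ c * (‖g₁ - g₂‖ + ‖y₁ - y₂‖) := by
    refine (abs_norm_sub_norm_le _ _).trans ?_
    rw [← map_sub]
    refine (hT _).trans ?_
    gcongr
    have : g₁ - y₁ - (g₂ - y₂) = (g₁ - g₂) - (y₁ - y₂) := by abel
    rw [this]; exact norm_sub_le _ _
  have hq := (gauss_lip a b).trans hab
  have hqa : Real.exp (-(a ^ 2 / 4)) ≤ 1 := Real.exp_le_one_iff.2 (by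
    have := sq_nonneg a; linarith)
  have hqb : Real.exp (-(b ^ 2 / 4)) ≤ 1 := Real.exp_le_one_iff.2 (by
    have := sq_nonneg b; linarith)
  have hqa0 := Real.exp_pos (-(a ^ 2 / 4))
  have hqb0 := Real.exp_pos (-(b ^ 2 / 4))
  have hq1 : |Real.exp (-(a ^ 2 / 4)) - Real.exp (-(b ^ 2 / 4))| ≤ 1 := by
    rw [abs_le]; constructor <;> linarith
  have hδ := norm_nonneg (y₁ - y₂)
  have hqq : |Real.exp (-(a ^ 2 / 4)) - Real.exp (-(b ^ 2 / 4))| ≤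
      (1 + c) * (min 1 ‖g₁ - g₂‖ + ‖y₁ - y₂‖) := by
    have hg := norm_nonneg (g₁ - g₂)
    rcases min_cases 1 ‖g₁ - g₂‖ with ⟨h, _⟩ | ⟨h, _⟩ <;> rw [h]
    · nlinarith [mul_nonneg hc hδ]
    · nlinarith [mul_nonneg hc hδ]
  have hm : 0 ≤ min 1 ‖g₁ - g₂‖ := le_min zero_le_one (norm_nonneg _)
  have key : rootD σ g₁ y₁ - rootD σ g₂ y₂ =
      (Real.exp (-(a ^ 2 / 4)) - Real.exp (-(b ^ 2 / 4))) * Real.exp (‖scaleT σ y₁‖ ^ 2 / 4)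
      + Real.exp (-(b ^ 2 / 4)) *
        (Real.exp (‖scaleT σ y₁‖ ^ 2 / 4) - Real.exp (‖scaleT σ y₂‖ ^ 2 / 4)) := by
    unfold rootD; ring
  rw [key]
  refine (abs_add_le _ _).trans ?_
  rw [abs_mul, abs_mul, abs_of_pos hqb0, abs_of_pos (Real.exp_pos (‖scaleT σ y₁‖ ^ 2 / 4))]
  calc _ ≤ ((1 + c) * (min 1 ‖g₁ - g₂‖ + ‖y₁ - y₂‖)) * K + 1 * (K * (c * r) * c * ‖y₁ - y₂‖) := by
        gcongr
    _ ≤ _ := by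
        have : 0 ≤ K * (c * r) * c * min 1 ‖g₁ - g₂‖ := by positivity
        nlinarith

lemma rootD_continuous {d : ℕ} (σ : Fin d → ℝ) (y : EuclideanSpace ℝ (Fin d)) :
    Continuous (fun g => rootD σ g y) := by
  have : Continuous (scaleT σ) := (LinearMap.toContinuousLinearMap (scaleT σ)).continuous
  unfold rootD
  fun_prop

/-- Normalising two `L²` functions. -/
lemma normalise {X : Type*} [MeasurableSpace X] (μ : Measure X) (a b : X → ℝ) (z : ℝ) (hz : 0 < z)
    (ha : Integrable (fun u => a u ^ 2) μ) (hb : Integrable (fun u => b u ^ 2) μ)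
    (hab : Integrable (fun u => a u * b u) μ)
    (hza : z ≤ ∫ u, a u ^ 2 ∂μ) (hzb : z ≤ ∫ u, b u ^ 2 ∂μ) :
    ∫ u, (a u / Real.sqrt (∫ u, a u ^ 2 ∂μ) - b u / Real.sqrt (∫ u, b u ^ 2 ∂μ)) ^ 2 ∂μ
      ≤ (∫ u, (a u - b u) ^ 2 ∂μ) / z := by
  set A := ∫ u, a u ^ 2 ∂μ with hA
  set D := ∫ u, b u ^ 2 ∂μ with hD
  have hApos : 0 < A := hz.trans_le hza
  have hDpos : 0 < D := hz.trans_le hzb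
  have hs := Real.sq_sqrt hApos.le
  have ht := Real.sq_sqrt hDpos.le
  have hs0 := Real.sqrt_pos.2 hApos
  have ht0 := Real.sqrt_pos.2 hDpos
  have hzs : Real.sqrt z ≤ Real.sqrt A := Real.sqrt_le_sqrt hza
  have hzt : Real.sqrt z ≤ Real.sqrt D := Real.sqrt_le_sqrt hzb
  have hzz := Real.mul_self_sqrt hz.le
  set s := Real.sqrt A
  set t := Real.sqrt D
  have hst : z ≤ s * t := by
    rw [← hzz]; exact mul_le_mul hzs hzt (Real.sqrt_nonneg _) hs0.le
  have gen : ∀ p q : ℝ, ∫ u, (p * a u - q * b u) ^ 2 ∂μ =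
      p ^ 2 * A + q ^ 2 * D - 2 * p * q * ∫ u, a u * b u ∂μ := by
    intro p q
    have : (fun u => (p * a u - q * b u) ^ 2) =
      fun u => p ^ 2 * a u ^ 2 + q ^ 2 * b u ^ 2 - 2 * p * q * (a u * b u) := by
      funext u; ring
    have hi : Integrable (fun u => p ^ 2 * a u ^ 2 + q ^ 2 * b u ^ 2) μ :=
      (ha.const_mul _).add (hb.const_mul _)
    rw [this, integral_sub hi (hab.const_mul _),
      integral_add (ha.const_mul _) (hb.const_mul _), integral_const_mul, integral_const_mul,
      integral_const_mul]
  have e1 : ∫ u, (a u / s - b u / t) ^ 2 ∂μ = 2 - 2 * (∫ u, a u * b u ∂μ) / (s * t) := by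
    have := gen s⁻¹ t⁻¹
    simp only [div_eq_inv_mul] at this ⊢
    rw [this, ← hs, ← ht]
    field_simp
    ring
  have e2 := gen 1 1
  simp only [one_mul] at e2
  have hDnn : 0 ≤ ∫ u, (a u - b u) ^ 2 ∂μ := integral_nonneg fun u => sq_nonneg _
  rw [e1]
  calc _ ≤ (∫ u, (a u - b u) ^ 2 ∂μ) / (s * t) := by
        rw [e2, le_div_iff₀ (by positivity)]
        have : (2 - 2 * (∫ u, a u * b u ∂μ) / (s * t)) * (s * t) =
          2 * (s * t) - 2 * (∫ u, a u * b u ∂μ) := by field_simp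
        rw [this]
        nlinarith [sq_nonneg (s - t)]
    _ ≤ _ := div_le_div_of_nonneg_left hDnn hz hst

theorem stmt_15 {X : Type*} [MeasurableSpace X] {d : ℕ} (hd : 1 ≤ d)
    (σ : Fin d → ℝ) (hσ : ∀ i, 0 < σ i)
    (μ₀ : Measure X) [IsProbabilityMeasure μ₀]
    (G : ℕ → X → EuclideanSpace ℝ (Fin d)) (Ginf : X → EuclideanSpace ℝ (Fin d))
    (hGm : ∀ m, Measurable (G m)) (hGinf : Measurable Ginf)
    (hconv : ∀ᵐ u ∂μ₀, Tendsto (fun m => G m u) atTop (nhds (Ginf u)))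
    (S : ℝ) (hGsq : ∀ m, Integrable (fun u => ‖G m u‖ ^ 2) μ₀)
    (hGsupS : ∀ m, (∫ u, ‖G m u‖ ^ 2 ∂μ₀) ≤ S)
    (hZinf : ∀ y : EuclideanSpace ℝ (Fin d), 0 < Zconst σ Ginf μ₀ y)
    (X₀ : Set X) (hX₀ : MeasurableSet X₀) (hX₀pos : 0 < μ₀ X₀)
    (B : ℝ) (hB : 0 ≤ B) (hGB : ∀ m, ∀ u ∈ X₀, ‖G m u‖ ≤ B) :
    ∀ r > (0 : ℝ), ∀ ε > (0 : ℝ), ∃ C > (0 : ℝ), ∃ M : ℕ, ∀ m₁ ≥ M, ∀ m₂ ≥ M,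
      ∀ y₁ y₂ : EuclideanSpace ℝ (Fin d), ‖y₁‖ ≤ r → ‖y₂‖ ≤ r →
      Real.sqrt (1 / 2 * ∫ u,
        (Real.sqrt (Real.exp (-(potential σ (G m₁) u y₁)) / Zconst σ (G m₁) μ₀ y₁) -
         Real.sqrt (Real.exp (-(potential σ (G m₂) u y₂)) / Zconst σ (G m₂) μ₀ y₂)) ^ 2 ∂μ₀)
        ≤ C * ‖y₁ - y₂‖ + ε := by
  intro r hr ε hε
  obtain ⟨c, hc, hT⟩ := exists_scale_bound σ
  obtain ⟨L, hL, hLip⟩ := rootD_lip σ r hr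
  -- measurability and integrability
  have hmeas : ∀ m y, Measurable (fun u => rootD σ (G m u) y) := fun m y =>
    (rootD_continuous σ y).measurable.comp (hGm m)
  have hint2 : ∀ m n y y', Integrable (fun u => rootD σ (G m u) y * rootD σ (G n u) y') μ₀ := by
    intro m n y y'
    refine Integrable.of_bound ((hmeas m y).mul (hmeas n y')).aestronglyMeasurable
      (Real.exp (‖scaleT σ y‖ ^ 2 / 4) * Real.exp (‖scaleT σ y'‖ ^ 2 / 4)) (ae_of_all _ fun u => ?_)
    have p1 := rootD_pos σ (G m u) y
    have p2 := rootD_pos σ (G n u) y'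
    rw [Real.norm_of_nonneg (by positivity)]
    exact mul_le_mul (rootD_le _ _ _) (rootD_le _ _ _) p2.le (Real.exp_pos _).le
  have hsq : ∀ m y, Integrable (fun u => rootD σ (G m u) y ^ 2) μ₀ := by
    intro m y; simpa [sq] using hint2 m m y y
  have hZ : ∀ m y, Zconst σ (G m) μ₀ y = ∫ u, rootD σ (G m u) y ^ 2 ∂μ₀ := by
    intro m y; unfold Zconst; simp_rw [rootD_sq]
  -- lower bound
  set w := Real.exp (-((c * (B + r)) ^ 2 / 2)) with hw
  have hwpos : 0 < w := Real.exp_pos _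
  have hμpos : 0 < μ₀.real X₀ := ENNReal.toReal_pos hX₀pos.ne' (measure_ne_top _ _)
  set z := w * μ₀.real X₀ with hzdef
  have hz : 0 < z := by positivity
  have hZlow : ∀ m y, ‖y‖ ≤ r → z ≤ ∫ u, rootD σ (G m u) y ^ 2 ∂μ₀ := by
    intro m y hy
    calc z = ∫ u in X₀, w ∂μ₀ := by simp [hzdef, mul_comm]
      _ ≤ ∫ u in X₀, rootD σ (G m u) y ^ 2 ∂μ₀ := by
        refine setIntegral_mono_on (integrable_const _).integrableOn (hsq m y).integrableOn hX₀ ?_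
        intro u hu
        rw [← rootD_sq σ (G m), hw]
        refine Real.exp_le_exp.2 (neg_le_neg ?_)
        unfold potential
        rw [gammaNormSq_eq, gammaNormSq_eq]
        have h1 : ‖scaleT σ (G m u - y)‖ ≤ c * (B + r) := by
          refine (hT _).trans ?_
          gcongr
          exact (norm_sub_le _ _).trans (add_le_add (hGB m u hu) hy)
        have h2 : ‖scaleT σ (G m u - y)‖ ^ 2 ≤ (c * (B + r)) ^ 2 := by gcongr
        nlinarith [sq_nonneg ‖scaleT σ y‖]
      _ ≤ _ := setIntegral_le_integral (hsq m y) (ae_of_all _ fun u => sq_nonneg _)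
  -- convergence
  set e : ℕ → X → ℝ := fun m u => (min 1 ‖G m u - Ginf u‖) ^ 2 with he
  have hmin0 : ∀ m u, 0 ≤ min 1 ‖G m u - Ginf u‖ := fun m u =>
    le_min zero_le_one (norm_nonneg _)
  have hemeas : ∀ m, Measurable (e m) := fun m =>
    (measurable_const.min ((hGm m).sub hGinf).norm).pow_const 2
  have hebd : ∀ m u, ‖e m u‖ ≤ 1 := by
    intro m u
    rw [Real.norm_of_nonneg (sq_nonneg _)]
    exact pow_le_one₀ (hmin0 m u) (min_le_left _ _)
  have heint : ∀ m, Integrable (e m) μ₀ := fun m =>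
    Integrable.of_bound (hemeas m).aestronglyMeasurable 1 (ae_of_all _ (hebd m))
  have hlim : Tendsto (fun m => ∫ u, e m u ∂μ₀) atTop (nhds 0) := by
    have := tendsto_integral_of_dominated_convergence (μ := μ₀) (F := e) (f := fun _ => (0 : ℝ))
      (fun _ => (1 : ℝ)) (fun m => (hemeas m).aestronglyMeasurable) (integrable_const _)
      (fun m => ae_of_all _ (hebd m)) (by
        filter_upwards [hconv] with u hu
        have h1 : Tendsto (fun m => ‖G m u - Ginf u‖) atTop (nhds 0) :=
          tendsto_iff_norm_sub_tendsto_zero.1 hu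
        have h2 := ((tendsto_const_nhds (x := (1 : ℝ))).min h1).pow 2
        simpa [he] using h2)
    simpa using this
  set κ := 3 * L ^ 2 / (2 * z) with hκ
  have hκ0 : 0 ≤ κ := by positivity
  have hη : 0 < ε ^ 2 / (2 * (κ + 1)) := by positivity
  obtain ⟨M, hM⟩ := eventually_atTop.1 (hlim.eventually (gt_mem_nhds hη))
  refine ⟨κ + 1, by positivity, M, ?_⟩
  intro m₁ hm₁ m₂ hm₂ y₁ y₂ hy₁ hy₂
  have hδ := norm_nonneg (y₁ - y₂)
  set δ := ‖y₁ - y₂‖ with hδdef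
  refine Real.sqrt_le_iff.2 ⟨by positivity, ?_⟩
  have hrw : ∀ u,
      (Real.sqrt (Real.exp (-(potential σ (G m₁) u y₁)) / Zconst σ (G m₁) μ₀ y₁) -
         Real.sqrt (Real.exp (-(potential σ (G m₂) u y₂)) / Zconst σ (G m₂) μ₀ y₂)) ^ 2 =
      (rootD σ (G m₁ u) y₁ / Real.sqrt (∫ u, rootD σ (G m₁ u) y₁ ^ 2 ∂μ₀) -
        rootD σ (G m₂ u) y₂ / Real.sqrt (∫ u, rootD σ (G m₂ u) y₂ ^ 2 ∂μ₀)) ^ 2 := by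
    intro u
    rw [rootD_sq, rootD_sq, hZ, hZ, Real.sqrt_div (sq_nonneg _), Real.sqrt_div (sq_nonneg _),
      Real.sqrt_sq (rootD_pos _ _ _).le, Real.sqrt_sq (rootD_pos _ _ _).le]
  simp_rw [hrw]
  have hN := normalise μ₀ (fun u => rootD σ (G m₁ u) y₁) (fun u => rootD σ (G m₂ u) y₂) z hz
    (hsq _ _) (hsq _ _) (hint2 _ _ _ _) (hZlow _ _ hy₁) (hZlow _ _ hy₂)
  have hDle : ∫ u, (rootD σ (G m₁ u) y₁ - rootD σ (G m₂ u) y₂) ^ 2 ∂μ₀ ≤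
      3 * L ^ 2 * (∫ u, e m₁ u ∂μ₀ + ∫ u, e m₂ u ∂μ₀ + δ ^ 2) := by
    have hI : Integrable (fun u => 3 * L ^ 2 * (e m₁ u + e m₂ u + δ ^ 2)) μ₀ :=
      (((heint m₁).add (heint m₂)).add (integrable_const _)).const_mul _
    have hval : ∫ u, 3 * L ^ 2 * (e m₁ u + e m₂ u + δ ^ 2) ∂μ₀ =
        3 * L ^ 2 * ((∫ u, e m₁ u ∂μ₀) + (∫ u, e m₂ u ∂μ₀) + δ ^ 2) := by
      have hi : Integrable (fun u => e m₁ u + e m₂ u) μ₀ := (heint m₁).add (heint m₂)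
      rw [integral_const_mul, integral_add hi (integrable_const _),
        integral_add (heint m₁) (heint m₂)]
      simp
    refine le_trans (integral_mono_of_nonneg (ae_of_all _ fun u => sq_nonneg _) hI
      (ae_of_all _ fun u => ?_)) (le_of_eq hval)
    have h1 := hLip (G m₁ u) (G m₂ u) y₁ y₂ hy₁ hy₂
    have h2 : min 1 ‖G m₁ u - G m₂ u‖ ≤
        min 1 ‖G m₁ u - Ginf u‖ + min 1 ‖G m₂ u - Ginf u‖ := by
      have tri : ‖G m₁ u - G m₂ u‖ ≤ ‖G m₁ u - Ginf u‖ + ‖G m₂ u - Ginf u‖ := by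
        rw [norm_sub_rev (G m₂ u)]; exact norm_sub_le_norm_sub_add_norm_sub _ _ _
      have q1 := norm_nonneg (G m₁ u - Ginf u)
      have q2 := norm_nonneg (G m₂ u - Ginf u)
      rcases min_cases 1 ‖G m₁ u - Ginf u‖ with ⟨h, _⟩ | ⟨h, _⟩ <;>
      rcases min_cases 1 ‖G m₂ u - Ginf u‖ with ⟨h', _⟩ | ⟨h', _⟩ <;> rw [h, h']
      · exact (min_le_left _ _).trans (by linarith)
      · exact (min_le_left _ _).trans (by linarith)
      · exact (min_le_left _ _).trans (by linarith)
      · exact (min_le_right _ _).trans tri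
    have h3 : |rootD σ (G m₁ u) y₁ - rootD σ (G m₂ u) y₂| ≤
        L * (min 1 ‖G m₁ u - Ginf u‖ + min 1 ‖G m₂ u - Ginf u‖ + δ) :=
      h1.trans (by gcongr)
    have h4 : (rootD σ (G m₁ u) y₁ - rootD σ (G m₂ u) y₂) ^ 2 ≤
        (L * (min 1 ‖G m₁ u - Ginf u‖ + min 1 ‖G m₂ u - Ginf u‖ + δ)) ^ 2 := by
      rw [← sq_abs]; gcongr
    refine h4.trans ?_
    simp only [he]
    generalize min 1 ‖G m₁ u - Ginf u‖ = p
    generalize min 1 ‖G m₂ u - Ginf u‖ = q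
    have : (p + q + δ) ^ 2 ≤ 3 * (p ^ 2 + q ^ 2 + δ ^ 2) := by
      nlinarith [sq_nonneg (p - q), sq_nonneg (p - δ), sq_nonneg (q - δ)]
    calc _ = L ^ 2 * (p + q + δ) ^ 2 := by ring
      _ ≤ L ^ 2 * (3 * (p ^ 2 + q ^ 2 + δ ^ 2)) := by gcongr
      _ = _ := by ring
  have hE1 := hM m₁ hm₁
  have hE2 := hM m₂ hm₂
  set E1 := ∫ u, e m₁ u ∂μ₀
  set E2 := ∫ u, e m₂ u ∂μ₀
  have hsum : E1 + E2 ≤ ε ^ 2 / (κ + 1) := by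
    have : ε ^ 2 / (κ + 1) = ε ^ 2 / (2 * (κ + 1)) + ε ^ 2 / (2 * (κ + 1)) := by
      field_simp; ring
    linarith
  have hκs : κ * (ε ^ 2 / (κ + 1)) ≤ ε ^ 2 := by
    rw [← mul_div_assoc, div_le_iff₀ (by positivity)]
    nlinarith [sq_nonneg ε]
  calc _ ≤ 1 / 2 * ((3 * L ^ 2 * (E1 + E2 + δ ^ 2)) / z) := by
        refine mul_le_mul_of_nonneg_left (hN.trans ?_) (by norm_num)
        gcongr
    _ = κ * (E1 + E2) + κ * δ ^ 2 := by rw [hκ]; field_simp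
    _ ≤ ε ^ 2 + (κ + 1) ^ 2 * δ ^ 2 := by
        have h1 := mul_le_mul_of_nonneg_left hsum hκ0
        have h2 : κ * δ ^ 2 ≤ (κ + 1) ^ 2 * δ ^ 2 := by
          gcongr; nlinarith
        linarith
    _ ≤ _ := by
        have : 0 ≤ (κ + 1) * δ * ε := by positivity
        nlinarith
end
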